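/- Every polynomially tamed function f on Σ_n is bounded by a monomial: there exist integers N_1, …, N_n such that |f| ≺ (y^1)^{N_1}⋯(y^n)^{N_n} on Σ_n. -/

import Mathlib

namespace TamePaper

noncomputable section

/-- The point space: `n` pairs of real coordinates `(x, y)`. -/
abbrev Pt (n : ℕ) := (Fin n → ℝ) × (Fin n → ℝ)

/-- The growth sector `Σ_n = {0 < xᵏ < 1, y¹ ≥ y² ≥ ⋯ ≥ yⁿ > 1}`. -/
def GrowthSector (n : ℕ) : Set (Pt n) :=
  {p | (∀ k, 0 < p.1 k ∧ p.1 k < 1) ∧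
       (∀ k l : Fin n, k ≤ l → p.2 l ≤ p.2 k) ∧ (∀ k, 1 < p.2 k)}

/-- `f ≺ g` on `S`: there is `C > 0` with `f < C·g` everywhere on `S`. -/
def Prec {α : Type*} (S : Set α) (f g : α → ℝ) : Prop :=
  ∃ C : ℝ, 0 < C ∧ ∀ p ∈ S, f p < C * g p

/-- `f ∼ g` on `S`: `C₁·g < f < C₂·g` on `S` for two constants of the same sign. -/
def Sim {α : Type*} (S : Set α) (f g : α → ℝ) : Prop :=
  ∃ C₁ C₂ : ℝ, 0 < C₁ * C₂ ∧ ∀ p ∈ S, C₁ * g p < f p ∧ f p < C₂ * g p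

/-- The closed unit polydisk in `ℝ^{2n}`. -/
def ClosedPolydisk (n : ℕ) : Set (Fin n → ℝ × ℝ) :=
  {q | ∀ k, (q k).1 ^ 2 + (q k).2 ^ 2 ≤ 1}

/-- A restricted analytic function: real-analytic on an open neighborhood of the
closed unit polydisk. -/
def RestrictedAnalytic (n : ℕ) (ρ : (Fin n → ℝ × ℝ) → ℝ) : Prop :=
  ∃ U : Set (Fin n → ℝ × ℝ), IsOpen U ∧ ClosedPolydisk n ⊆ U ∧ AnalyticOnNhd ℝ ρ U

/-- The coordinates `uᵏ = e^{-2πyᵏ} cos(2πxᵏ)`, `vᵏ = e^{-2πyᵏ} sin(2πxᵏ)`. -/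
def uv (n : ℕ) (p : Pt n) : Fin n → ℝ × ℝ := fun k =>
  (Real.exp (-(2 * Real.pi * p.2 k)) * Real.cos (2 * Real.pi * p.1 k),
   Real.exp (-(2 * Real.pi * p.2 k)) * Real.sin (2 * Real.pi * p.1 k))

/-- Membership in the ring `O`: on `Σ_n`, `f` is given by a restricted analytic
function of the variables `uᵏ, vᵏ`. -/
def InO (n : ℕ) (f : Pt n → ℝ) : Prop :=
  ∃ ρ, RestrictedAnalytic n ρ ∧ ∀ p ∈ GrowthSector n, f p = ρ (uv n p)

/-- The monomial `(y¹)^{m₁} ⋯ (yⁿ)^{mₙ}`. -/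
def monomial (n : ℕ) (m : Fin n → ℤ) : Pt n → ℝ := fun p => ∏ k, p.2 k ^ m k

/-- Membership in `O[x,y,y⁻¹]`: a finite sum `∑ ρ_{k,m} x^k y^m` with `ρ_{k,m} ∈ O`,
`k ∈ ℕⁿ`, `m ∈ ℤⁿ`. -/
def InOPoly (n : ℕ) (f : Pt n → ℝ) : Prop :=
  ∃ (T : Finset ((Fin n → ℕ) × (Fin n → ℤ)))
    (ρ : ((Fin n → ℕ) × (Fin n → ℤ)) → Pt n → ℝ),
    (∀ km ∈ T, InO n (ρ km)) ∧
    ∀ p ∈ GrowthSector n,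
      f p = ∑ km ∈ T, ρ km p * (∏ k, p.1 k ^ km.1 k) * (∏ k, p.2 k ^ km.2 k)

/-- Membership in `O(x,y)`: a quotient `g/h` with `g, h ∈ O[x,y,y⁻¹]` and `h`
nowhere vanishing on `Σ_n`. -/
def InOFrac (n : ℕ) (f : Pt n → ℝ) : Prop :=
  ∃ g h, InOPoly n g ∧ InOPoly n h ∧ (∀ p ∈ GrowthSector n, h p ≠ 0) ∧
    ∀ p ∈ GrowthSector n, f p = g p / h p

/-- `f` has monomial growth: `f ∼ (y¹)^{m₁}⋯(yⁿ)^{mₙ}` on `Σ_n` for some `m ∈ ℤⁿ`. -/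
def MonGrowth (n : ℕ) (f : Pt n → ℝ) : Prop :=
  ∃ m : Fin n → ℤ, Sim (GrowthSector n) f (monomial n m)

/-- `f` is monomially tamed: `f ∈ O(x,y)` and `f ∼ (y¹)^{m₁}⋯(yⁿ)^{mₙ}` on `Σ_n`. -/
def MonTamed (n : ℕ) (f : Pt n → ℝ) : Prop := InOFrac n f ∧ MonGrowth n f

/-- `f` is polynomially tamed: `f = g/h` with `g ∈ O[x,y,y⁻¹]` and `h` monomially tamed. -/
def PolyTamed (n : ℕ) (f : Pt n → ℝ) : Prop :=
  ∃ g h, InOPoly n g ∧ MonTamed n h ∧ (∀ p ∈ GrowthSector n, h p ≠ 0) ∧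
    ∀ p ∈ GrowthSector n, f p = g p / h p

lemma isCompact_polydisk (n : ℕ) : IsCompact (ClosedPolydisk n) := by
  have hK : IsCompact (Set.univ.pi fun _ : Fin n =>
      (Set.Icc (-1 : ℝ) 1 ×ˢ Set.Icc (-1 : ℝ) 1)) :=
    isCompact_univ_pi fun _ => isCompact_Icc.prod isCompact_Icc
  refine hK.of_isClosed_subset ?_ ?_
  · have : ClosedPolydisk n = ⋂ k, {q | (q k).1 ^ 2 + (q k).2 ^ 2 ≤ 1} := by
      ext q; simp [ClosedPolydisk]
    rw [this]
    refine isClosed_iInter fun k => isClosed_le (by fun_prop) continuous_const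
  · intro q hq k _
    have := hq k
    refine ⟨⟨?_, ?_⟩, ⟨?_, ?_⟩⟩ <;> nlinarith [sq_nonneg (q k).1, sq_nonneg (q k).2]

lemma uv_mem (n : ℕ) (p : Pt n) (hp : p ∈ GrowthSector n) : uv n p ∈ ClosedPolydisk n := by
  intro k
  have h1 : Real.exp (-(2 * Real.pi * p.2 k)) ≤ 1 := by
    rw [Real.exp_le_one_iff]
    have := hp.2.2 k
    have := Real.pi_pos
    have : 0 < 2 * Real.pi * p.2 k := by positivity
    linarith
  have h0 := Real.exp_pos (-(2 * Real.pi * p.2 k))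
  have : (uv n p k).1 ^ 2 + (uv n p k).2 ^ 2 = Real.exp (-(2 * Real.pi * p.2 k)) ^ 2 := by
    simp only [uv]
    linear_combination (Real.exp (-(2 * Real.pi * p.2 k)) ^ 2) *
      Real.sin_sq_add_cos_sq (2 * Real.pi * p.1 k)
  rw [this]
  nlinarith

lemma inO_bdd (n : ℕ) (f : Pt n → ℝ) (hf : InO n f) :
    ∃ M : ℝ, 0 ≤ M ∧ ∀ p ∈ GrowthSector n, |f p| ≤ M := by
  obtain ⟨ρ, ⟨U, _, hU, hρ⟩, h⟩ := hf
  obtain ⟨M, hM⟩ := (isCompact_polydisk n).exists_bound_of_continuousOn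
    (hρ.continuousOn.mono hU)
  refine ⟨max M 0, le_max_right _ _, fun p hp => ?_⟩
  rw [h p hp]
  exact (hM _ (uv_mem n p hp)).trans (le_max_left _ _)

lemma monomial_pos' (n : ℕ) (m : Fin n → ℤ) (p : Pt n) (hp : p ∈ GrowthSector n) :
    0 < monomial n m p :=
  Finset.prod_pos fun k _ => zpow_pos (by linarith [hp.2.2 k]) _

lemma inOPoly_bdd (n : ℕ) (g : Pt n → ℝ) (hg : InOPoly n g) :
    ∃ N : Fin n → ℤ, ∃ M : ℝ, 0 ≤ M ∧ ∀ p ∈ GrowthSector n, |g p| ≤ M * monomial n N p := by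
  obtain ⟨T, ρ, hρ, h⟩ := hg
  have hM : ∀ km, ∃ M : ℝ, 0 ≤ M ∧ (km ∈ T → ∀ p ∈ GrowthSector n, |ρ km p| ≤ M) := by
    intro km
    by_cases hk : km ∈ T
    · obtain ⟨M, h0, hM⟩ := inO_bdd n _ (hρ km hk)
      exact ⟨M, h0, fun _ => hM⟩
    · exact ⟨0, le_rfl, fun h => absurd h hk⟩
  choose M hM0 hM using hM
  refine ⟨fun k => ∑ km ∈ T, |km.2 k|, ∑ km ∈ T, M km, Finset.sum_nonneg fun _ _ => hM0 _, ?_⟩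
  intro p hp
  rw [h p hp, Finset.sum_mul]
  refine (Finset.abs_sum_le_sum_abs _ _).trans (Finset.sum_le_sum fun km hk => ?_)
  have hx0 : 0 ≤ ∏ k, p.1 k ^ km.1 k :=
    Finset.prod_nonneg fun k _ => pow_nonneg (hp.1 k).1.le _
  have hx1 : ∏ k, p.1 k ^ km.1 k ≤ 1 :=
    Finset.prod_le_one (fun k _ => pow_nonneg (hp.1 k).1.le _)
      fun k _ => pow_le_one₀ (hp.1 k).1.le (hp.1 k).2.le
  have hy0 := monomial_pos' n km.2 p hp
  have hy : monomial n km.2 p ≤ monomial n (fun k => ∑ km ∈ T, |km.2 k|) p := by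
    refine Finset.prod_le_prod (fun k _ => zpow_nonneg (by linarith [hp.2.2 k]) _) fun k _ => ?_
    refine zpow_le_zpow_right₀ (hp.2.2 k).le ((le_abs_self _).trans ?_)
    exact Finset.single_le_sum (f := fun km : (Fin n → ℕ) × (Fin n → ℤ) => |km.2 k|)
      (fun _ _ => abs_nonneg _) hk
  rw [abs_mul, abs_mul, abs_of_nonneg hx0]
  change _ * |monomial n km.2 p| ≤ _
  rw [abs_of_pos hy0]
  refine mul_le_mul ?_ hy hy0.le (hM0 _)
  calc |ρ km p| * _ ≤ |ρ km p| * 1 := mul_le_mul_of_nonneg_left hx1 (abs_nonneg _)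
    _ ≤ M km := by rw [mul_one]; exact hM km hk p hp

/-- Every polynomially tamed function `f` on `Σ_n` is bounded by a
monomial: there are integers `N₁, …, Nₙ` with `|f| ≺ (y¹)^{N₁}⋯(yⁿ)^{Nₙ}` on `Σ_n`. -/
theorem statement17 (n : ℕ) (hn : 1 ≤ n) (f : Pt n → ℝ) (hf : PolyTamed n f) :
    ∃ N : Fin n → ℤ, Prec (GrowthSector n) (fun p => |f p|) (monomial n N) := by
  obtain ⟨g, h, hg, ⟨_, m, C₁, C₂, hC, hh⟩, _, hf⟩ := hf
  obtain ⟨N, M, hM0, hM⟩ := inOPoly_bdd n g hg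
  obtain ⟨c, hc, hch⟩ : ∃ c : ℝ, 0 < c ∧ ∀ p ∈ GrowthSector n, c * monomial n m p ≤ |h p| := by
    rcases pos_and_pos_or_neg_and_neg_of_mul_pos hC with ⟨h1, h2⟩ | ⟨h1, h2⟩
    · exact ⟨C₁, h1, fun p hp => (hh p hp).1.le.trans (le_abs_self _)⟩
    · refine ⟨-C₂, by linarith, fun p hp => le_trans ?_ (neg_le_abs _)⟩
      have := (hh p hp).2
      linarith
  refine ⟨fun k => N k - m k, M / c + 1, by positivity, fun p hp => ?_⟩
  have hN := monomial_pos' n N p hp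
  have hm := monomial_pos' n m p hp
  have e : monomial n (fun k => N k - m k) p = monomial n N p / monomial n m p := by
    simp only [monomial]
    rw [← Finset.prod_div_distrib]
    refine Finset.prod_congr rfl fun k _ => zpow_sub₀ (by linarith [hp.2.2 k]) _ _
  have hq := monomial_pos' n (fun k => N k - m k) p hp
  have key : |f p| ≤ M / c * monomial n (fun k => N k - m k) p := by
    rw [hf p hp, abs_div, e]
    calc |g p| / |h p| ≤ (M * monomial n N p) / (c * monomial n m p) :=
          div_le_div₀ (by positivity) (hM p hp) (by positivity) (hch p hp)
      _ = _ := by field_simp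
  change |f p| < _
  linarith

end

end TamePaper
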